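/- arXiv:math/0606620 — 2 statements merged into one kernel-verified Lean document; each statement's English description precedes it below -/
import Mathlib

section
/- One has H̃ ⊂ D(Ā), and ‖Ā ỹ‖_-² ≤ 2(α² ‖U_α‖² + 1) ‖ỹ‖_∼² for all ỹ ∈ H̃. Consequently the identity map from (H̃,‖·‖_∼) to (D(Ā),‖·‖_{Ā}) is a continuous embedding, where ‖x̄‖_{Ā} = ‖x̄‖_- + ‖Ā x̄‖_-. -/
open MeasureTheory Real Filter
open scoped ENNReal InnerProductSpace NNReal

noncomputable section

/-- A strongly continuous semigroup of bounded linear operators on `H`. -/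
def IsC0 {H : Type*} [NormedAddCommGroup H] [NormedSpace ℝ H]
    (T : ℝ → H →L[ℝ] H) : Prop :=
  T 0 = ContinuousLinearMap.id ℝ H ∧
  (∀ s t : ℝ, 0 ≤ s → 0 ≤ t → T (s + t) = (T s).comp (T t)) ∧
  ∀ x : H, ContinuousOn (fun t => T t x) (Set.Ici 0)

/-- An entrance path for `(T_t)` (normalized to vanish on `(-∞,0]`). -/
def IsEntrance {H : Type*} [NormedAddCommGroup H] [NormedSpace ℝ H]
    (T : ℝ → H →L[ℝ] H) (x : ℝ → H) : Prop :=
  (∀ s : ℝ, s ≤ 0 → x s = 0) ∧ ∀ r t : ℝ, 0 < r → 0 < t → x (r + t) = T t (x r)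

/-- Membership in the entrance space `H̃`: a locally square integrable entrance path. -/
def MemHt {H : Type*} [NormedAddCommGroup H] [NormedSpace ℝ H]
    (T : ℝ → H →L[ℝ] H) (x : ℝ → H) : Prop :=
  IsEntrance T x ∧ ∃ l > (0:ℝ), ∫⁻ s in Set.Ioo 0 l, (‖x s‖₊ : ℝ≥0∞) ^ 2 < ⊤

/-- The induced operator `T̃_t` on entrance paths: `(T̃_t x̃)(s) = x̃(t+s)`. -/
def shiftT {H : Type*} [NormedAddCommGroup H] (t : ℝ) (x : ℝ → H) : ℝ → H :=
  fun s => if 0 < s then x (t + s) else 0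

/-- The norm `‖x̃‖_∼` of the entrance space `H̃`. -/
def normSim {H : Type*} [NormedAddCommGroup H] (b : ℝ) (x : ℝ → H) : ℝ :=
  Real.sqrt (∫ s in Set.Ioi 0, Real.exp (-2 * b * s) * ‖x s‖ ^ 2)

/-- The weaker norm `‖x̃‖_-` obtained from the resolvent `U_α`. -/
def normMinus {H : Type*} [NormedAddCommGroup H] [NormedSpace ℝ H]
    (b : ℝ) (U : H →L[ℝ] H) (x : ℝ → H) : ℝ :=
  Real.sqrt (∫ s in Set.Ioi 0, Real.exp (-2 * b * s) * ‖U (x s)‖ ^ 2)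

section ResolventOrbit

variable {H : Type*} [NormedAddCommGroup H] [InnerProductSpace ℝ H]
  {T : ℝ → H →L[ℝ] H} {c₀ b₀ b α : ℝ} {U : H →L[ℝ] H} {y : ℝ → H}

lemma IsC0.continuousOn_exp_smul (hT : IsC0 T) (α : ℝ) (x : H) :
    ContinuousOn (fun u : ℝ => Real.exp (-α * u) • T u x) (Set.Ici 0) :=
  (by fun_prop : Continuous fun u : ℝ => Real.exp (-α * u)).continuousOn.smul (hT.2.2 x)

lemma norm_exp_smul_le (hbd : ∀ t : ℝ, 0 ≤ t → ‖T t‖ ≤ c₀ * Real.exp (b₀ * t))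
    (x : H) {u : ℝ} (hu : 0 ≤ u) :
    ‖Real.exp (-α * u) • T u x‖ ≤ c₀ * ‖x‖ * Real.exp (-(α - b₀) * u) := by
  rw [norm_smul, Real.norm_eq_abs, abs_of_pos (Real.exp_pos _)]
  calc Real.exp (-α * u) * ‖T u x‖
      ≤ Real.exp (-α * u) * (c₀ * Real.exp (b₀ * u) * ‖x‖) := by
        gcongr
        exact ((T u).le_opNorm x).trans (by gcongr; exact hbd u hu)
    _ = c₀ * ‖x‖ * (Real.exp (-α * u) * Real.exp (b₀ * u)) := by ring
    _ = c₀ * ‖x‖ * Real.exp (-(α - b₀) * u) := by rw [← Real.exp_add]; ring_nf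

lemma integrableOn_exp_smul (hα : b₀ < α) (hT : IsC0 T)
    (hbd : ∀ t : ℝ, 0 ≤ t → ‖T t‖ ≤ c₀ * Real.exp (b₀ * t)) (x : H) :
    IntegrableOn (fun u : ℝ => Real.exp (-α * u) • T u x) (Set.Ioi 0) := by
  refine Integrable.mono' ((exp_neg_integrableOn_Ioi 0 (sub_pos.2 hα)).const_mul (c₀ * ‖x‖))
    (((hT.continuousOn_exp_smul α x).mono Set.Ioi_subset_Ici_self).aestronglyMeasurable
      measurableSet_Ioi) ?_
  filter_upwards [ae_restrict_mem measurableSet_Ioi] with u hu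
  exact norm_exp_smul_le hbd x (le_of_lt hu)

/-- The resolvent along an orbit, as a function of time. -/
lemma resolvent_orbit_eq (hα : b₀ < α) (hT : IsC0 T)
    (hbd : ∀ t : ℝ, 0 ≤ t → ‖T t‖ ≤ c₀ * Real.exp (b₀ * t))
    (hU : ∀ y : H, U y = ∫ t in Set.Ioi 0, Real.exp (-α * t) • T t y)
    (x : H) {t : ℝ} (ht : 0 ≤ t) :
    U (T t x) = Real.exp (α * t) • (U x - ∫ u in (0 : ℝ)..t, Real.exp (-α * u) • T u x) := by
  have hsplit := intervalIntegral.integral_Ioi_sub_Ioi (integrableOn_exp_smul hα hT hbd x) ht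
  rw [hU x, ← hsplit, sub_sub_cancel, hU, ← integral_smul]
  have hshift := (measurePreserving_add_right (volume : Measure ℝ) t).setIntegral_preimage_emb
    (measurableEmbedding_addRight t)
    (fun u : ℝ => Real.exp (α * t) • Real.exp (-α * u) • T u x) (Set.Ioi t)
  rw [← hshift]
  have hpre : (fun u : ℝ => u + t) ⁻¹' Set.Ioi t = Set.Ioi 0 := by ext; simp
  rw [hpre]
  refine setIntegral_congr_fun measurableSet_Ioi fun u hu => ?_
  simp only [hT.2.1 u t (le_of_lt hu) ht, smul_smul, ← Real.exp_add,
    ContinuousLinearMap.comp_apply]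
  congr 2
  ring

lemma norm_inv_smul_resolvent_sub_le (hc₀ : 0 ≤ c₀) (hb₀ : 0 ≤ b₀) (hα : b₀ < α) (hT : IsC0 T)
    (hbd : ∀ t : ℝ, 0 ≤ t → ‖T t‖ ≤ c₀ * Real.exp (b₀ * t))
    (hU : ∀ y : H, U y = ∫ t in Set.Ioi 0, Real.exp (-α * t) • T t y)
    (x : H) {t : ℝ} (ht : t ∈ Set.Ioo (0 : ℝ) 1) :
    ‖t⁻¹ • (U (T t x) - U x)‖ ≤ Real.exp α * (α * ‖U‖ + c₀) * ‖x‖ := by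
  obtain ⟨ht0, ht1⟩ := ht
  have hα0 : 0 < α := hb₀.trans_lt hα
  have hint : ‖∫ u in (0 : ℝ)..t, Real.exp (-α * u) • T u x‖ ≤ c₀ * ‖x‖ * t := by
    have h := intervalIntegral.norm_integral_le_of_norm_le_const (a := 0) (b := t)
      (f := fun u : ℝ => Real.exp (-α * u) • T u x) (C := c₀ * ‖x‖) ?_
    · simpa [abs_of_pos ht0] using h
    · intro u hu
      rw [Set.uIoc_of_le ht0.le] at hu
      refine (norm_exp_smul_le hbd x hu.1.le).trans ?_
      refine mul_le_of_le_one_right (by positivity) (Real.exp_le_one_iff.2 ?_)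
      nlinarith [hu.1]
  have hexp : Real.exp (α * t) - 1 ≤ Real.exp (α * t) * (α * t) := by
    have h1 := Real.add_one_le_exp (-(α * t))
    have h2 : Real.exp (α * t) * Real.exp (-(α * t)) = 1 := by rw [← Real.exp_add]; simp
    nlinarith [Real.exp_pos (α * t)]
  have hexp0 : 0 ≤ Real.exp (α * t) - 1 := sub_nonneg.2 (Real.one_le_exp (by positivity))
  have hle : Real.exp (α * t) ≤ Real.exp α := Real.exp_le_exp.2 (by nlinarith)
  have hdec : U (T t x) - U x = (Real.exp (α * t) - 1) • U x
      - Real.exp (α * t) • ∫ u in (0 : ℝ)..t, Real.exp (-α * u) • T u x := by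
    rw [resolvent_orbit_eq hα hT hbd hU x ht0.le, smul_sub, sub_smul, one_smul]
    abel
  have hnum : ‖U (T t x) - U x‖ ≤ t * (Real.exp α * (α * ‖U‖ + c₀) * ‖x‖) := by
    rw [hdec]
    calc _ ≤ ‖(Real.exp (α * t) - 1) • U x‖
          + ‖Real.exp (α * t) • ∫ u in (0 : ℝ)..t, Real.exp (-α * u) • T u x‖ := norm_sub_le _ _
      _ = (Real.exp (α * t) - 1) * ‖U x‖
          + Real.exp (α * t) * ‖∫ u in (0 : ℝ)..t, Real.exp (-α * u) • T u x‖ := by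
        rw [norm_smul, norm_smul, Real.norm_of_nonneg hexp0,
          Real.norm_of_nonneg (Real.exp_pos _).le]
      _ ≤ Real.exp (α * t) * (α * t) * (‖U‖ * ‖x‖) + Real.exp (α * t) * (c₀ * ‖x‖ * t) := by
        gcongr
        exact U.le_opNorm x
      _ = Real.exp (α * t) * (t * ((α * ‖U‖ + c₀) * ‖x‖)) := by ring
      _ ≤ Real.exp α * (t * ((α * ‖U‖ + c₀) * ‖x‖)) := by gcongr
      _ = _ := by ring
  rw [norm_smul, norm_inv, Real.norm_of_nonneg ht0.le, inv_mul_le_iff₀ ht0]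
  exact hnum

lemma tendsto_inv_smul_resolvent_sub [CompleteSpace H] (hα : b₀ < α) (hT : IsC0 T)
    (hbd : ∀ t : ℝ, 0 ≤ t → ‖T t‖ ≤ c₀ * Real.exp (b₀ * t))
    (hU : ∀ y : H, U y = ∫ t in Set.Ioi 0, Real.exp (-α * t) • T t y) (x : H) :
    Tendsto (fun t : ℝ => t⁻¹ • (U (T t x) - U x)) (nhdsWithin 0 (Set.Ioi 0))
      (nhds (α • U x - x)) := by
  have hcont := hT.continuousOn_exp_smul α x
  have hint : HasDerivWithinAt (fun t : ℝ => ∫ u in (0 : ℝ)..t, Real.exp (-α * u) • T u x)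
      (Real.exp (-α * 0) • T 0 x) (Set.Ici 0) 0 :=
    intervalIntegral.integral_hasDerivWithinAt_right (t := Set.Ioi 0)
      IntervalIntegrable.refl
      ((hcont.mono Set.Ioi_subset_Ici_self).stronglyMeasurableAtFilter_nhdsWithin
        measurableSet_Ioi 0)
      ((hcont 0 Set.self_mem_Ici).mono Set.Ioi_subset_Ici_self)
  have hexp : HasDerivWithinAt (fun t : ℝ => Real.exp (α * t)) α (Set.Ici 0) 0 := by
    have h := ((hasDerivAt_id (0 : ℝ)).const_mul α).exp.hasDerivWithinAt (s := Set.Ici 0)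
    simpa using h
  have hF := (hexp.smul (hint.const_sub (U x))).mono Set.Ioi_subset_Ici_self
  rw [hasDerivWithinAt_iff_tendsto_slope' Set.self_notMem_Ioi] at hF
  have hlim : Real.exp (α * 0) • -(Real.exp (-α * 0) • T 0 x)
      + α • (U x - ∫ u in (0 : ℝ)..0, Real.exp (-α * u) • T u x) = α • U x - x := by
    simp [hT.1, sub_eq_add_neg, add_comm]
  rw [hlim] at hF
  refine hF.congr' ?_
  filter_upwards [self_mem_nhdsWithin] with t ht
  rw [resolvent_orbit_eq hα hT hbd hU x (le_of_lt ht)]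
  simp [slope]

lemma IsEntrance.continuousOn (hT : IsC0 T) (hy : IsEntrance T y) :
    ContinuousOn y (Set.Ioi 0) := by
  intro s hs
  have hs' : 0 < s / 2 := half_pos hs
  have h : ContinuousOn (fun u => T (u - s / 2) (y (s / 2))) (Set.Ici (s / 2)) :=
    (hT.2.2 (y (s / 2))).comp (by fun_prop) fun u hu => Set.mem_Ici.2 (sub_nonneg.2 hu)
  have hmem : Set.Ioi (s / 2) ∈ nhds s := Ioi_mem_nhds (half_lt_self hs)
  have h' := (h.mono Set.Ioi_subset_Ici_self).continuousAt hmem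
  refine (h'.congr ?_).continuousWithinAt
  filter_upwards [hmem] with u hu
  rw [← hy.2 (s / 2) (u - s / 2) hs' (sub_pos.2 hu), add_sub_cancel]

lemma MemHt.integrableOn (hc₀ : 0 ≤ c₀) (hb₀ : 0 ≤ b₀) (hb : b₀ < b) (hT : IsC0 T)
    (hbd : ∀ t : ℝ, 0 ≤ t → ‖T t‖ ≤ c₀ * Real.exp (b₀ * t)) (hy : MemHt T y) :
    IntegrableOn (fun s => Real.exp (-2 * b * s) * ‖y s‖ ^ 2) (Set.Ioi 0) := by
  obtain ⟨hye, l, hl, hfin⟩ := hy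
  have hyc := hye.continuousOn hT
  have hmeas : AEStronglyMeasurable (fun s => Real.exp (-2 * b * s) * ‖y s‖ ^ 2)
      (volume.restrict (Set.Ioi 0)) :=
    ContinuousOn.aestronglyMeasurable
      ((by fun_prop : Continuous fun s : ℝ => Real.exp (-2 * b * s)).continuousOn.mul
        (hyc.norm.pow 2)) measurableSet_Ioi
  have hl2 : 0 < l / 2 := half_pos hl
  have hsub : Set.Ioo 0 l ⊆ Set.Ioi (0 : ℝ) := Set.Ioo_subset_Ioi_self
  have hsub' : Set.Ioi (l / 2) ⊆ Set.Ioi (0 : ℝ) := Set.Ioi_subset_Ioi hl2.le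
  have hsq : IntegrableOn (fun s => ‖y s‖ ^ 2) (Set.Ioo 0 l) := by
    refine ⟨((hyc.mono hsub).norm.pow 2).aestronglyMeasurable measurableSet_Ioo, ?_⟩
    rw [hasFiniteIntegral_iff_enorm]
    convert hfin using 3 with s
    simp [enorm_eq_nnnorm]
  have hnear : IntegrableOn (fun s => Real.exp (-2 * b * s) * ‖y s‖ ^ 2) (Set.Ioo 0 l) := by
    refine Integrable.mono' hsq (hmeas.mono_set hsub) ?_
    filter_upwards [ae_restrict_mem measurableSet_Ioo] with s hs
    rw [Real.norm_of_nonneg (by positivity)]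
    refine mul_le_of_le_one_left (by positivity) (Real.exp_le_one_iff.2 ?_)
    nlinarith [hs.1]
  have hfar : IntegrableOn (fun s => Real.exp (-2 * b * s) * ‖y s‖ ^ 2) (Set.Ioi (l / 2)) := by
    refine Integrable.mono'
      ((exp_neg_integrableOn_Ioi (l / 2) (b := 2 * (b - b₀)) (by linarith)).const_mul
        ((c₀ * ‖y (l / 2)‖) ^ 2)) (hmeas.mono_set hsub') ?_
    filter_upwards [ae_restrict_mem measurableSet_Ioi] with s hs
    have hs' : 0 < s - l / 2 := sub_pos.2 hs
    have hle : ‖y s‖ ≤ c₀ * ‖y (l / 2)‖ * Real.exp (b₀ * s) := by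
      have heq : y s = T (s - l / 2) (y (l / 2)) := by
        rw [← hye.2 _ _ hl2 hs', add_sub_cancel]
      rw [heq]
      calc _ ≤ ‖T (s - l / 2)‖ * ‖y (l / 2)‖ := (T _).le_opNorm _
        _ ≤ c₀ * Real.exp (b₀ * (s - l / 2)) * ‖y (l / 2)‖ := by
          gcongr
          exact hbd _ hs'.le
        _ ≤ c₀ * Real.exp (b₀ * s) * ‖y (l / 2)‖ := by
          gcongr
          linarith
        _ = _ := by ring
    rw [Real.norm_of_nonneg (by positivity)]
    calc _ ≤ Real.exp (-2 * b * s) * (c₀ * ‖y (l / 2)‖ * Real.exp (b₀ * s)) ^ 2 := by gcongr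
      _ = (c₀ * ‖y (l / 2)‖) ^ 2
          * (Real.exp (-2 * b * s) * (Real.exp (b₀ * s) * Real.exp (b₀ * s))) := by ring
      _ = _ := by
        rw [← Real.exp_add, ← Real.exp_add]
        ring_nf
  refine (hnear.union hfar).mono_set fun s hs => ?_
  by_cases h : s < l
  · exact Or.inl ⟨hs, h⟩
  · exact Or.inr (lt_of_lt_of_le (half_lt_self hl) (not_lt.1 h))

/-- Dominated convergence for `normMinus`. -/
lemma tendsto_normMinus_of_dominated {ι : Type*} {l : Filter ι} [l.IsCountablyGenerated]
    {x : ι → ℝ → H} {g : ℝ → H} {C : ℝ}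
    (hy : IntegrableOn (fun s => Real.exp (-2 * b * s) * ‖y s‖ ^ 2) (Set.Ioi 0))
    (hcont : ∀ᶠ i in l, ContinuousOn (fun s => U (x i s)) (Set.Ioi 0))
    (hdom : ∀ᶠ i in l, ∀ s, 0 < s → ‖U (x i s)‖ ≤ C * ‖y s‖)
    (hlim : ∀ s, 0 < s → Tendsto (fun i => U (x i s)) l (nhds (g s))) :
    Tendsto (fun i => normMinus b U (x i)) l
      (nhds (Real.sqrt (∫ s in Set.Ioi 0, Real.exp (-2 * b * s) * ‖g s‖ ^ 2))) := by
  refine (Real.continuous_sqrt.tendsto _).comp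
    (tendsto_integral_filter_of_dominated_convergence
      (fun s => C ^ 2 * (Real.exp (-2 * b * s) * ‖y s‖ ^ 2)) ?_ ?_ (hy.const_mul _) ?_)
  · filter_upwards [hcont] with i hi
    exact ContinuousOn.aestronglyMeasurable
      ((by fun_prop : Continuous fun s : ℝ => Real.exp (-2 * b * s)).continuousOn.mul
        (hi.norm.pow 2)) measurableSet_Ioi
  · filter_upwards [hdom] with i hi
    filter_upwards [ae_restrict_mem measurableSet_Ioi] with s hs
    rw [Real.norm_of_nonneg (by positivity)]
    calc _ ≤ Real.exp (-2 * b * s) * (C * ‖y s‖) ^ 2 := by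
          gcongr
          exact hi s hs
      _ = _ := by ring
  · filter_upwards [ae_restrict_mem measurableSet_Ioi] with s hs
    exact ((hlim s hs).norm.pow 2).const_mul _

lemma norm_smul_sub_sq_le (U : H →L[ℝ] H) (α : ℝ) (x : H) :
    ‖α • U x - x‖ ^ 2 ≤ 2 * (α ^ 2 * ‖U‖ ^ 2 + 1) * ‖x‖ ^ 2 := by
  have h1 : ‖α • U x - x‖ ≤ |α| * (‖U‖ * ‖x‖) + ‖x‖ := by
    refine (norm_sub_le _ _).trans ?_
    rw [norm_smul, Real.norm_eq_abs]
    gcongr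
    exact U.le_opNorm x
  calc _ ≤ (|α| * (‖U‖ * ‖x‖) + ‖x‖) ^ 2 := by gcongr
    _ ≤ 2 * ((|α| * (‖U‖ * ‖x‖)) ^ 2 + ‖x‖ ^ 2) := add_sq_le
    _ = _ := by rw [mul_pow, sq_abs]; ring

lemma normMinus_le (U : H →L[ℝ] H)
    (hy : IntegrableOn (fun s => Real.exp (-2 * b * s) * ‖y s‖ ^ 2) (Set.Ioi 0)) :
    normMinus b U y ≤ ‖U‖ * normSim b y := by
  refine Real.sqrt_le_iff.2 ⟨mul_nonneg (norm_nonneg _) (Real.sqrt_nonneg _), ?_⟩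
  rw [mul_pow, normSim, Real.sq_sqrt (integral_nonneg fun s => by positivity),
    ← integral_const_mul]
  refine integral_mono_of_nonneg (ae_of_all _ fun s => by positivity) (hy.const_mul _)
    (ae_of_all _ fun s => ?_)
  calc _ ≤ Real.exp (-2 * b * s) * (‖U‖ * ‖y s‖) ^ 2 := by
        dsimp only
        gcongr
        exact U.le_opNorm _
    _ = _ := by ring

end ResolventOrbit

/-- **Lemma 4.2.** `H̃ ⊂ D(Ā)` and `‖Ā ỹ‖_-² ≤ 2(α²‖U_α‖² + 1)‖ỹ‖_∼²` for `ỹ ∈ H̃`;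
consequently the identity map from `(H̃,‖·‖_∼)` to `(D(Ā),‖·‖_Ā)` is a continuous
embedding.  Here `Ā` is the generator of the extension `(T̄_t)` of `(T̃_t)` to the
completion `H̄` of `(H̃,‖·‖_-)`; membership `ỹ ∈ D(Ā)` is expressed by the
`‖·‖_-`-Cauchy property of the difference quotients `t⁻¹(T̃_t ỹ - ỹ)` as `t → 0⁺`,
and `Ā ỹ` is their `‖·‖_-`-limit in `H̄`. -/
theorem entrance_space_subset_domain_of_generator
    {H : Type*} [NormedAddCommGroup H] [InnerProductSpace ℝ H] [CompleteSpace H]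
    (T : ℝ → H →L[ℝ] H) (c₀ b₀ b α : ℝ) (hc₀ : 0 ≤ c₀) (hb₀ : 0 ≤ b₀)
    (hb : b₀ < b) (hα : b₀ < α)
    (hT : IsC0 T) (hbd : ∀ t : ℝ, 0 ≤ t → ‖T t‖ ≤ c₀ * Real.exp (b₀ * t))
    (U : H →L[ℝ] H) (hU : ∀ y : H, U y = ∫ t in Set.Ioi 0, Real.exp (-α * t) • T t y)
    (y : ℝ → H) (hy : MemHt T y) :
    -- `ỹ ∈ D(Ā)`: the difference quotients are `‖·‖_-`-Cauchy as `t → 0⁺`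
    (∀ ε : ℝ, 0 < ε → ∃ δ > (0:ℝ), ∀ t₁ ∈ Set.Ioo 0 δ, ∀ t₂ ∈ Set.Ioo 0 δ,
      normMinus b U (t₁⁻¹ • (shiftT t₁ y - y) - t₂⁻¹ • (shiftT t₂ y - y)) < ε) ∧
    -- `‖Ā ỹ‖_-² ≤ 2(α²‖U_α‖² + 1)‖ỹ‖_∼²`
    (∀ ε : ℝ, 0 < ε → ∃ δ > (0:ℝ), ∀ t ∈ Set.Ioo 0 δ,
      normMinus b U (t⁻¹ • (shiftT t y - y)) ^ 2
        ≤ 2 * (α ^ 2 * ‖U‖ ^ 2 + 1) * normSim b y ^ 2 + ε) ∧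
    -- consequently `‖ỹ‖_Ā = ‖ỹ‖_- + ‖Ā ỹ‖_- ≤ C ‖ỹ‖_∼`
    (∀ ε : ℝ, 0 < ε → ∃ δ > (0:ℝ), ∀ t ∈ Set.Ioo 0 δ,
      normMinus b U y + normMinus b U (t⁻¹ • (shiftT t y - y))
        ≤ (‖U‖ + Real.sqrt (2 * (α ^ 2 * ‖U‖ ^ 2 + 1))) * normSim b y + ε) := by
  have hyi := hy.integrableOn hc₀ hb₀ hb hT hbd
  have hyc := hy.1.continuousOn hT
  set l : Filter ℝ := nhdsWithin 0 (Set.Ioi 0) with hl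
  set x : ℝ → ℝ → H := fun t => t⁻¹ • (shiftT t y - y) with hx
  set C : ℝ := Real.exp α * (α * ‖U‖ + c₀) with hC
  have hxs : ∀ t s : ℝ, 0 < t → 0 < s → U (x t s) = t⁻¹ • (U (T t (y s)) - U (y s)) := by
    intro t s ht hs
    simp [hx, shiftT, hs, add_comm t s, hy.1.2 s t hs ht]
  have hIoo : ∀ᶠ t in l, t ∈ Set.Ioo (0 : ℝ) 1 := Ioo_mem_nhdsGT one_pos
  have hcont : ∀ᶠ t in l, ContinuousOn (fun s => U (x t s)) (Set.Ioi 0) := by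
    filter_upwards [hIoo] with t ht
    have h : ContinuousOn (fun s => t⁻¹ • (U (T t (y s)) - U (y s))) (Set.Ioi 0) := by
      fun_prop
    exact h.congr fun s hs => hxs t s ht.1 hs
  have hdom : ∀ᶠ t in l, ∀ s, 0 < s → ‖U (x t s)‖ ≤ C * ‖y s‖ := by
    filter_upwards [hIoo] with t ht s hs
    rw [hxs t s ht.1 hs]
    exact norm_inv_smul_resolvent_sub_le hc₀ hb₀ hα hT hbd hU (y s) ht
  have hlim : ∀ s, 0 < s → Tendsto (fun t => U (x t s)) l (nhds (α • U (y s) - y s)) := by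
    intro s hs
    refine (tendsto_inv_smul_resolvent_sub hα hT hbd hU (y s)).congr' ?_
    filter_upwards [hIoo] with t ht
    exact (hxs t s ht.1 hs).symm
  have hmain := tendsto_normMinus_of_dominated hyi hcont hdom hlim
  have hbound : Real.sqrt (∫ s in Set.Ioi 0, Real.exp (-2 * b * s) * ‖α • U (y s) - y s‖ ^ 2)
      ≤ Real.sqrt (2 * (α ^ 2 * ‖U‖ ^ 2 + 1)) * normSim b y := by
    rw [normSim, ← Real.sqrt_mul (by positivity), ← integral_const_mul]
    refine Real.sqrt_le_sqrt (integral_mono_of_nonneg (ae_of_all _ fun s => by positivity)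
      (hyi.const_mul _) (ae_of_all _ fun s => ?_))
    calc _ ≤ Real.exp (-2 * b * s) * (2 * (α ^ 2 * ‖U‖ ^ 2 + 1) * ‖y s‖ ^ 2) := by
          dsimp only
          gcongr
          exact norm_smul_sub_sq_le U α (y s)
      _ = _ := by ring
  have hdelta : ∀ {p : ℝ → Prop}, (∀ᶠ t in l, p t) → ∃ δ > (0:ℝ), ∀ t ∈ Set.Ioo 0 δ, p t := by
    intro p hp
    obtain ⟨δ, hδ, h⟩ := mem_nhdsGT_iff_exists_Ioo_subset.1 hp
    exact ⟨δ, hδ, fun t ht => h ht⟩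
  refine ⟨fun ε hε => ?_, fun ε hε => ?_, fun ε hε => ?_⟩
  · have hdiff : Tendsto (fun q : ℝ × ℝ => normMinus b U (x q.1 - x q.2)) (l ×ˢ l)
        (nhds (Real.sqrt (∫ s in Set.Ioi (0 : ℝ), Real.exp (-2 * b * s) * ‖(0 : H)‖ ^ 2))) := by
      refine tendsto_normMinus_of_dominated (C := 2 * C) (g := fun _ => 0) hyi ?_ ?_ ?_
      · filter_upwards [tendsto_fst.eventually hcont, tendsto_snd.eventually hcont] with q h1 h2
        simpa only [Pi.sub_apply, map_sub] using h1.fun_sub h2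
      · filter_upwards [tendsto_fst.eventually hdom, tendsto_snd.eventually hdom] with q h1 h2 s hs
        rw [Pi.sub_apply, map_sub]
        linarith [norm_sub_le (U (x q.1 s)) (U (x q.2 s)), h1 s hs, h2 s hs]
      · intro s hs
        simpa only [Pi.sub_apply, map_sub, sub_self, Function.comp_def] using
          ((hlim s hs).comp tendsto_fst).sub ((hlim s hs).comp tendsto_snd)
    simp only [norm_zero, ne_eq, OfNat.ofNat_ne_zero, not_false_eq_true, zero_pow, mul_zero,
      integral_zero, Real.sqrt_zero] at hdiff
    obtain ⟨p, hp, q, hq, hpq⟩ := eventually_prod_iff.1 (hdiff.eventually_lt_const hε)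
    obtain ⟨δ, hδ, h⟩ := hdelta (hp.and hq)
    exact ⟨δ, hδ, fun t₁ h₁ t₂ h₂ => hpq (h t₁ h₁).1 (h t₂ h₂).2⟩
  · refine hdelta (((hmain.pow 2).eventually_lt_const (u := _ + ε) ?_).mono fun t ht => ht.le)
    refine lt_of_le_of_lt (pow_le_pow_left₀ (Real.sqrt_nonneg _) hbound 2) ?_
    rw [mul_pow, Real.sq_sqrt (by positivity)]
    exact lt_add_of_pos_right _ hε
  · refine hdelta ((hmain.eventually_lt_const (lt_add_of_pos_right _ hε)).mono fun t ht => ?_)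
    linarith [normMinus_le U hyi]
end
end

section
/- Let ν be a Borel measure on ℝ. Then ∫_0^l ∫_ℝ ∫_ℝ g₁(2s, y−x) ν(dy) ν(dx) ds < ∞ for some l > 0 if and only if ∫_ℝ ∫_ℝ exp{−(y−x)²/4} ν(dy) ν(dx) < ∞. -/
open MeasureTheory Real Filter
open scoped ENNReal NNReal

noncomputable section

/-- The one-dimensional Gaussian kernel `g₁(s,x) = (2πs)^{-1/2} e^{-x²/2s}`. -/
def gauss1 (s x : ℝ) : ℝ :=
  (2 * Real.pi * s) ^ (-(1 : ℝ) / 2) * Real.exp (-x ^ 2 / (2 * s))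

lemma lintegral_eq_tsum_setLIntegral_Ico (ν : Measure ℝ) (f : ℝ → ℝ≥0∞) :
    ∫⁻ x, f x ∂ν = ∑' n : ℤ, ∫⁻ x in Set.Ico (n : ℝ) (n + 1), f x ∂ν := by
  rw [← lintegral_iUnion (fun _ => measurableSet_Ico) (Set.pairwise_disjoint_Ico_intCast ℝ),
    iUnion_Ico_intCast ℝ, Measure.restrict_univ]

/-- A kernel bounded below near the diagonal has double integral bounded below by the sum of
squared masses of unit cells. -/
lemma mul_tsum_sq_le_lintegral_lintegral (ν : Measure ℝ) (f : ℝ → ℝ≥0∞) (c : ℝ≥0∞)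
    (hf : ∀ u, |u| ≤ 1 → c ≤ f u) :
    c * ∑' n : ℤ, ν (Set.Ico (n : ℝ) (n + 1)) ^ 2 ≤ ∫⁻ x, ∫⁻ y, f (y - x) ∂ν ∂ν := by
  rw [lintegral_eq_tsum_setLIntegral_Ico ν, ← ENNReal.tsum_mul_left]
  refine ENNReal.tsum_le_tsum fun n => ?_
  calc c * ν (Set.Ico (n : ℝ) (n + 1)) ^ 2
      = ∫⁻ _ in Set.Ico (n : ℝ) (n + 1), ∫⁻ _ in Set.Ico (n : ℝ) (n + 1), c ∂ν ∂ν := by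
        simp only [setLIntegral_const]; ring
    _ ≤ _ := by
        refine setLIntegral_mono' measurableSet_Ico fun x hx => ?_
        refine (setLIntegral_mono' measurableSet_Ico fun y hy => ?_).trans
          (setLIntegral_le_lintegral _ _)
        exact hf _ (abs_le.2 ⟨by linarith [hx.2, hy.1], by linarith [hx.1, hy.2]⟩)

/-- A kernel dominated on each pair of unit cells by `c` of the distance between the cells has
double integral bounded by the sum of squared masses of unit cells. -/
lemma lintegral_lintegral_le_mul_tsum_sq (ν : Measure ℝ) (f : ℝ → ℝ≥0∞) (c : ℤ → ℝ≥0∞)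
    (hf : ∀ (k : ℤ) (u : ℝ), |u - k| ≤ 1 → f u ≤ c k) :
    ∫⁻ x, ∫⁻ y, f (y - x) ∂ν ∂ν ≤
      (∑' k, c k) * (2 * ∑' n : ℤ, ν (Set.Ico (n : ℝ) (n + 1)) ^ 2) := by
  set a : ℤ → ℝ≥0∞ := fun n => ν (Set.Ico (n : ℝ) (n + 1)) with ha
  have hinner : ∀ n : ℤ, ∀ x ∈ Set.Ico (n : ℝ) (n + 1),
      ∫⁻ y, f (y - x) ∂ν ≤ ∑' k : ℤ, c k * a (n + k) := by
    intro n x hx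
    rw [lintegral_eq_tsum_setLIntegral_Ico ν, ← (Equiv.addLeft n).tsum_eq]
    refine ENNReal.tsum_le_tsum fun k => ?_
    rw [← setLIntegral_const]
    refine setLIntegral_mono' measurableSet_Ico fun y hy => hf k _ ?_
    simp only [Equiv.coe_addLeft, Int.cast_add, Set.mem_Ico] at hy
    exact abs_le.2 ⟨by linarith [hx.2, hy.1], by linarith [hx.1, hy.2]⟩
  have hmul : ∀ p q : ℝ≥0∞, p * q ≤ p ^ 2 + q ^ 2 := by
    intro p q
    rcases le_total p q with h | h
    · exact (mul_le_mul_left h q).trans (by rw [← sq]; exact le_add_self)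
    · exact (mul_le_mul_right h p).trans (by rw [← sq]; exact le_self_add)
  calc ∫⁻ x, ∫⁻ y, f (y - x) ∂ν ∂ν
      ≤ ∑' n : ℤ, (∑' k : ℤ, c k * a (n + k)) * a n := by
        rw [lintegral_eq_tsum_setLIntegral_Ico ν]
        refine ENNReal.tsum_le_tsum fun n => ?_
        rw [ha, ← setLIntegral_const]
        exact setLIntegral_mono' measurableSet_Ico (hinner n)
    _ = ∑' k : ℤ, c k * ∑' n : ℤ, a (n + k) * a n := by
        simp_rw [← ENNReal.tsum_mul_right, ← ENNReal.tsum_mul_left]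
        rw [ENNReal.tsum_comm]
        simp_rw [mul_assoc]
    _ ≤ ∑' k : ℤ, c k * (2 * ∑' n : ℤ, a n ^ 2) := by
        refine ENNReal.tsum_le_tsum fun k => mul_le_mul_right ?_ _
        calc ∑' n : ℤ, a (n + k) * a n
            ≤ ∑' n : ℤ, (a (n + k) ^ 2 + a n ^ 2) := ENNReal.tsum_le_tsum fun n => hmul _ _
          _ = 2 * ∑' n : ℤ, a n ^ 2 := by
            rw [ENNReal.tsum_add, two_mul]
            exact congrArg (· + _) ((Equiv.addRight k).tsum_eq fun n => a n ^ 2)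
    _ = _ := ENNReal.tsum_mul_right

lemma exp_neg_sq_div_four_le (k : ℤ) (u : ℝ) (hu : |u - k| ≤ 1) :
    Real.exp (-u ^ 2 / 4) ≤ 16 * (1 / |(k : ℝ) + 1 / 2| ^ (2 : ℝ)) := by
  have hk : (k : ℝ) + 1 / 2 ≠ 0 := by
    intro h
    have h' : ((2 * k + 1 : ℤ) : ℝ) = 0 := by push_cast; linarith
    have := Int.cast_eq_zero.1 h'
    omega
  have hk2 : 0 < ((k : ℝ) + 1 / 2) ^ 2 := by positivity
  have hsq : (u - k) ^ 2 ≤ 1 := (sq_le_one_iff_abs_le_one _).2 hu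
  have hexp : Real.exp (-u ^ 2 / 4) ≤ 1 / (1 + u ^ 2 / 4) := by
    rw [neg_div, Real.exp_neg, ← one_div]
    exact one_div_le_one_div_of_le (by positivity) (by linarith [Real.add_one_le_exp (u ^ 2 / 4)])
  refine hexp.trans ?_
  rw [Real.rpow_two, sq_abs, mul_one_div, div_le_div_iff₀ (by positivity) hk2]
  nlinarith [sq_nonneg (2 * u - k), sq_nonneg ((k : ℝ) - 1)]

lemma lintegral_gauss1_lt_top_of_lintegral_exp_lt_top (ν : Measure ℝ)
    (h : ∫⁻ x, ∫⁻ y, ENNReal.ofReal (Real.exp (-(y - x) ^ 2 / 4)) ∂ν ∂ν < ⊤) :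
    ∫⁻ s in Set.Ioo 0 (1 : ℝ),
      ∫⁻ x, ∫⁻ y, ENNReal.ofReal (gauss1 (2 * s) (y - x)) ∂ν ∂ν < ⊤ := by
  set A := ∫⁻ x, ∫⁻ y, ENNReal.ofReal (Real.exp (-(y - x) ^ 2 / 4)) ∂ν ∂ν
  have hint : IntegrableOn (fun s : ℝ => s ^ (-(1 : ℝ) / 2)) (Set.Ioo 0 1) :=
    (intervalIntegral.integrableOn_Ioo_rpow_iff one_pos).2 (by norm_num)
  have hle : ∀ s ∈ Set.Ioo (0 : ℝ) 1,
      ∫⁻ x, ∫⁻ y, ENNReal.ofReal (gauss1 (2 * s) (y - x)) ∂ν ∂ν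
        ≤ ENNReal.ofReal (s ^ (-(1 : ℝ) / 2)) * A := by
    intro s hs
    rw [← lintegral_const_mul' _ _ ENNReal.ofReal_ne_top]
    refine lintegral_mono fun x => ?_
    rw [← lintegral_const_mul' _ _ ENNReal.ofReal_ne_top]
    refine lintegral_mono fun y => ?_
    rw [← ENNReal.ofReal_mul (Real.rpow_nonneg hs.1.le _)]
    refine ENNReal.ofReal_le_ofReal ?_
    refine mul_le_mul ?_ (Real.exp_le_exp.2 ?_) (Real.exp_nonneg _) (Real.rpow_nonneg hs.1.le _)
    · exact Real.rpow_le_rpow_of_nonpos hs.1 (by nlinarith [Real.pi_gt_three, hs.1]) (by norm_num)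
    · rw [neg_div, neg_div, neg_le_neg_iff]
      exact div_le_div_of_nonneg_left (sq_nonneg _) (by linarith [hs.1]) (by linarith [hs.2])
  refine (setLIntegral_mono' measurableSet_Ioo hle).trans_lt ?_
  rw [lintegral_mul_const' _ _ h.ne]
  exact ENNReal.mul_lt_top hint.lintegral_lt_top h

lemma lintegral_exp_lt_top_of_lintegral_gauss1_lt_top (ν : Measure ℝ) {t : ℝ} (ht : 0 < t)
    (h : ∫⁻ x, ∫⁻ y, ENNReal.ofReal (gauss1 t (y - x)) ∂ν ∂ν < ⊤) :
    ∫⁻ x, ∫⁻ y, ENNReal.ofReal (Real.exp (-(y - x) ^ 2 / 4)) ∂ν ∂ν < ⊤ := by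
  have hpos : 0 < gauss1 t 1 := by unfold gauss1; positivity
  have hlow := mul_tsum_sq_le_lintegral_lintegral ν (fun u => ENNReal.ofReal (gauss1 t u))
    (ENNReal.ofReal (gauss1 t 1)) fun u hu => by
      refine ENNReal.ofReal_le_ofReal (mul_le_mul_of_nonneg_left (Real.exp_le_exp.2 ?_) ?_)
      · have := (sq_le_one_iff_abs_le_one u).2 hu
        exact div_le_div_of_nonneg_right (by linarith) (by positivity)
      · positivity
  have hsum : ∑' n : ℤ, ν (Set.Ico (n : ℝ) (n + 1)) ^ 2 < ⊤ :=
    ENNReal.lt_top_of_mul_ne_top_right (hlow.trans_lt h).ne (by simpa using hpos)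
  have hsummable : Summable fun k : ℤ => 16 * (1 / |(k : ℝ) + 1 / 2| ^ (2 : ℝ)) :=
    ((Real.summable_one_div_int_add_rpow (1 / 2) 2).2 (by norm_num)).mul_left 16
  refine (lintegral_lintegral_le_mul_tsum_sq ν (fun u => ENNReal.ofReal (Real.exp (-u ^ 2 / 4)))
    _ fun k u hu => ENNReal.ofReal_le_ofReal (exp_neg_sq_div_four_le k u hu)).trans_lt ?_
  exact ENNReal.mul_lt_top hsummable.tsum_ofReal_lt_top
    (ENNReal.mul_lt_top ENNReal.ofNat_lt_top hsum)

/-- **(5.4).**  For a Borel measure `ν` on `ℝ`, the condition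
`∫_0^l ∫∫ g₁(2s, y-x) ν(dx) ν(dy) ds < ∞` for some `l > 0` (defining the class
`S(ℝ)` for `d = 1`) holds if and only if
`∫∫ e^{-(y-x)²/4} ν(dx) ν(dy) < ∞`. -/
theorem dimension_one_entrance_measure_condition (ν : Measure ℝ) :
    (∃ l > (0:ℝ), ∫⁻ s in Set.Ioo 0 l,
        ∫⁻ x, ∫⁻ y, ENNReal.ofReal (gauss1 (2 * s) (y - x)) ∂ν ∂ν < ⊤) ↔
    (∫⁻ x, ∫⁻ y, ENNReal.ofReal (Real.exp (-(y - x) ^ 2 / 4)) ∂ν ∂ν < ⊤) := by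
  refine ⟨?_, fun h => ⟨1, one_pos, lintegral_gauss1_lt_top_of_lintegral_exp_lt_top ν h⟩⟩
  rintro ⟨l, hl, h⟩
  by_contra hexp
  refine h.ne ?_
  have htop : ∀ s ∈ Set.Ioo 0 l,
      ∫⁻ x, ∫⁻ y, ENNReal.ofReal (gauss1 (2 * s) (y - x)) ∂ν ∂ν = ⊤ := fun s hs =>
    not_lt_top_iff.1 fun hlt =>
      hexp (lintegral_exp_lt_top_of_lintegral_gauss1_lt_top ν (mul_pos two_pos hs.1) hlt)
  rw [setLIntegral_congr_fun measurableSet_Ioo htop, setLIntegral_const, Real.volume_Ioo]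
  exact ENNReal.top_mul (by simpa using hl)
end
end
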